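/- Let ε ∈ (0, 0.015). There exist t₁ > 0 and C > 0 (depending on n, D, ε) such that for all t ∈ (0, t₁) and every continuous function f: ℝ → ℝ that is differentiable except at finitely many points and satisfies L_t[f] < ε, the non-smoothness measure satisfies R[f] ≥ 2(n − 1 − 2n√ε)/t − C · exp(−Δ²/(10t)). -/

import Mathlib

open MeasureTheory Real Set Filter
open scoped ENNReal

/-- Centered Gaussian density with standard deviation `σ`. -/
noncomputable def gaussD (x σ : ℝ) : ℝ :=
  (Real.sqrt (2 * Real.pi) * σ)⁻¹ * Real.exp (-x ^ 2 / (2 * σ ^ 2))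

/-- Training points `y_k = 2(k-1)Δ - D`, `Δ = D/(n-1)`. -/
noncomputable def trainPt (n : ℕ) (D : ℝ) (k : ℕ) : ℝ :=
  2 * ((k : ℝ) - 1) * (D / ((n : ℝ) - 1)) - D

/-- Noised empirical density `p_t`. -/
noncomputable def pEmp (n : ℕ) (D t x : ℝ) : ℝ :=
  (1 / (n : ℝ)) * ∑ k ∈ Finset.Icc 1 n, gaussD (x - trainPt n D k) (Real.sqrt t)

/-- Empirical score function `(d/dx) log p_t`. -/
noncomputable def scoreEmp (n : ℕ) (D t x : ℝ) : ℝ :=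
  deriv (fun y => Real.log (pEmp n D t y)) x

/-- Score matching loss `L_t[f]`. -/
noncomputable def scoreLoss (n : ℕ) (D t : ℝ) (f : ℝ → ℝ) : ℝ :=
  t * ∫ x, |f x - scoreEmp n D t x| ^ 2 * pEmp n D t x

/-- `F(κ) = 2 ∫_κ^∞ (u-κ)² p_N(u;1) du`. -/
noncomputable def Fgauss (κ : ℝ) : ℝ :=
  2 * ∫ u in Set.Ioi κ, (u - κ) ^ 2 * gaussD u 1

/-- The smoothed piecewise-linear empirical score function `ŝ_{t,δ}` (as a predicate
characterizing it by its defining piecewise formulas). -/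
def IsShat (n : ℕ) (D t δ : ℝ) (s : ℝ → ℝ) : Prop :=
  (∀ x ≤ trainPt n D 1 + δ, s x = (trainPt n D 1 - x) / t) ∧
  (∀ x, trainPt n D n - δ ≤ x → s x = (trainPt n D n - x) / t) ∧
  (∀ k, 2 ≤ k → k ≤ n - 1 →
    ∀ x ∈ Set.Icc (trainPt n D k - δ) (trainPt n D k + δ),
      s x = (trainPt n D k - x) / t) ∧
  (∀ k, 1 ≤ k → k ≤ n - 1 →
    ∀ x ∈ Set.Icc (trainPt n D k + δ) (trainPt n D (k + 1) - δ),
      s x = (δ / (D / ((n : ℝ) - 1) - δ)) * (x - (trainPt n D k + D / ((n : ℝ) - 1))) / t)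

/-- Non-smoothness measure `R[f]`: the total variation over ℝ of the derivative `f'`
(taken over the set where `f` is differentiable). -/
noncomputable def Rns (f : ℝ → ℝ) : ℝ≥0∞ :=
  eVariationOn (deriv f) {x | DifferentiableAt ℝ f x}

/-- If the derivative of `f` has finite total variation over the points of differentiability, then
`deriv f` is bounded. -/
lemma exists_abs_deriv_le_of_Rns_ne_top {f : ℝ → ℝ} (hR : Rns f ≠ ⊤) :
    ∃ B, 0 ≤ B ∧ ∀ x, |deriv f x| ≤ B := by
  by_cases hne : ∃ x₀, DifferentiableAt ℝ f x₀
  · obtain ⟨x₀, hx₀⟩ := hne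
    refine ⟨(Rns f).toReal + |deriv f x₀|, by positivity, fun x => ?_⟩
    by_cases hx : DifferentiableAt ℝ f x
    · have h := eVariationOn.edist_le (deriv f) (s := {x | DifferentiableAt ℝ f x}) hx hx₀
      rw [edist_dist] at h
      have h2 : dist (deriv f x) (deriv f x₀) ≤ (Rns f).toReal :=
        (ENNReal.ofReal_le_iff_le_toReal hR).1 h
      rw [Real.dist_eq] at h2
      have := abs_sub_abs_le_abs_sub (deriv f x) (deriv f x₀)
      linarith
    · rw [deriv_zero_of_not_differentiableAt hx, abs_zero]
      positivity
  · push Not at hne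
    exact ⟨0, le_rfl, fun x => by rw [deriv_zero_of_not_differentiableAt (hne x), abs_zero]⟩

lemma intervalIntegrable_deriv_of_abs_le {f : ℝ → ℝ} {B : ℝ} (hB : ∀ x, |deriv f x| ≤ B)
    (a b : ℝ) : IntervalIntegrable (deriv f) volume a b :=
  (intervalIntegrable_const (c := B)).mono_fun' (measurable_deriv f).aestronglyMeasurable
    (Eventually.of_forall hB)

lemma integral_deriv_eq_sub_of_finite {f : ℝ → ℝ} (hf : Continuous f)
    (hfin : {x | ¬ DifferentiableAt ℝ f x}.Finite) {B : ℝ} (hB : ∀ x, |deriv f x| ≤ B) (a b : ℝ) :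
    ∫ x in a..b, deriv f x = f b - f a :=
  integral_eq_of_hasDerivAt_off_countable f (deriv f) hfin.countable hf.continuousOn
    (fun _ hx => (not_not.1 hx.2).hasDerivAt) (intervalIntegrable_deriv_of_abs_le hB a b)

lemma exists_deriv_lt_of_sub_lt {f : ℝ → ℝ} (hf : Continuous f)
    (hfin : {x | ¬ DifferentiableAt ℝ f x}.Finite) {B : ℝ} (hB : ∀ x, |deriv f x| ≤ B)
    {a b m : ℝ} (hab : a < b) (h : f b - f a < m * (b - a)) :
    ∃ x ∈ Ioo a b, DifferentiableAt ℝ f x ∧ deriv f x < m := by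
  by_contra! hcon
  rw [← integral_deriv_eq_sub_of_finite hf hfin hB a b] at h
  have hmono : ∫ _ in a..b, m ≤ ∫ x in a..b, deriv f x := by
    refine intervalIntegral.integral_mono_ae_restrict hab.le intervalIntegrable_const
      (intervalIntegrable_deriv_of_abs_le hB a b) ?_
    rw [restrict_Ioo_eq_restrict_Icc.symm]
    filter_upwards [ae_restrict_mem measurableSet_Ioo,
      ae_restrict_of_ae (compl_mem_ae_iff.2 (hfin.measure_zero volume))] with x hx hx'
    exact hcon x hx (not_not.1 hx')
  rw [intervalIntegral.integral_const, smul_eq_mul] at hmono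
  linarith

lemma exists_deriv_pos_of_lt {f : ℝ → ℝ} (hf : Continuous f)
    (hfin : {x | ¬ DifferentiableAt ℝ f x}.Finite) {B : ℝ} (hB : ∀ x, |deriv f x| ≤ B)
    {a b : ℝ} (hab : a < b) (h : f a < f b) :
    ∃ x ∈ Ioo a b, DifferentiableAt ℝ f x ∧ 0 < deriv f x := by
  have hset : {x | ¬ DifferentiableAt ℝ (fun y => -f y) x} = {x | ¬ DifferentiableAt ℝ f x} := by
    ext x
    simp [differentiableAt_fun_neg_iff]
  obtain ⟨x, hx, hd, hlt⟩ := exists_deriv_lt_of_sub_lt (f := fun y => -f y) (m := 0) (B := B)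
    hf.neg (by rw [hset]; exact hfin) (fun x => by rw [deriv.fun_neg, abs_neg]; exact hB x) hab
    (by linarith)
  rw [deriv.fun_neg] at hlt
  exact ⟨x, hx, differentiableAt_fun_neg_iff.1 hd, by linarith⟩

/-- One oscillation `-c → positive → -c'` of `g` adds `c + c'` to its variation. -/
lemma eVariationOn_inter_Iic_add_le {g : ℝ → ℝ} {S : Set ℝ} {p q p' c c' : ℝ}
    (hp : p ∈ S) (hq : q ∈ S) (hp' : p' ∈ S) (hpq : p ≤ q) (hqp' : q ≤ p')
    (hgp : g p ≤ -c) (hgq : 0 ≤ g q) (hgp' : g p' ≤ -c') (hc : 0 ≤ c) (hc' : 0 ≤ c') :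
    eVariationOn g (S ∩ Iic p) + ENNReal.ofReal (c + c') ≤ eVariationOn g (S ∩ Iic p') := by
  have hstep : ENNReal.ofReal (c + c') ≤ eVariationOn g (S ∩ Icc p p') := by
    have h₁ : ENNReal.ofReal c ≤ eVariationOn g (S ∩ Icc p q) := by
      refine le_trans ?_ (eVariationOn.edist_le g (x := p) (y := q) ⟨hp, le_rfl, hpq⟩
        ⟨hq, hpq, le_rfl⟩)
      rw [edist_dist, Real.dist_eq]
      refine ENNReal.ofReal_le_ofReal ?_
      rw [abs_sub_comm]
      exact le_trans (by linarith) (le_abs_self _)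
    have h₂ : ENNReal.ofReal c' ≤ eVariationOn g (S ∩ Icc q p') := by
      refine le_trans ?_ (eVariationOn.edist_le g (x := q) (y := p') ⟨hq, le_rfl, hqp'⟩
        ⟨hp', hqp', le_rfl⟩)
      rw [edist_dist, Real.dist_eq]
      refine ENNReal.ofReal_le_ofReal ?_
      exact le_trans (by linarith) (le_abs_self _)
    rw [ENNReal.ofReal_add hc hc']
    refine (add_le_add h₁ h₂).trans ((eVariationOn.add_le_union g ?_).trans
      (eVariationOn.mono g ?_))
    · exact fun x hx y hy => hx.2.2.trans hy.2.1
    · rintro x (hx | hx)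
      · exact ⟨hx.1, hx.2.1, hx.2.2.trans hqp'⟩
      · exact ⟨hx.1, hpq.trans hx.2.1, hx.2.2⟩
  refine (add_le_add le_rfl hstep).trans ((eVariationOn.add_le_union g ?_).trans
    (eVariationOn.mono g ?_))
  · exact fun x hx y hy => le_trans hx.2 hy.2.1
  · rintro x (hx | hx)
    · exact ⟨hx.1, le_trans hx.2 (hpq.trans hqp')⟩
    · exact ⟨hx.1, hx.2.2⟩

/-- If near each `y k` with `c k > 0` the function `f` crosses from positive to negative values
with a slope at most `-c k`, then its derivative varies by at least `2 ∑ c k - 2 A`. -/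
lemma ofReal_le_Rns_of_crossings {f : ℝ → ℝ}
    (hpos : ∀ a b, a < b → f a < f b → ∃ x ∈ Ioo a b, DifferentiableAt ℝ f x ∧ 0 < deriv f x)
    {n : ℕ} {y c : ℕ → ℝ} {ρ A : ℝ} (hA : 0 ≤ A) (hc : ∀ k, 0 ≤ c k) (hcA : ∀ k, c k ≤ A)
    (hy : ∀ k, y k + ρ < y (k + 1) - ρ) (hρ : 0 ≤ ρ)
    (hcross : ∀ k ∈ Finset.Icc 1 n, 0 < c k → ∃ l p r, y k - ρ ≤ l ∧ l < p ∧ p < r ∧ r ≤ y k + ρ ∧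
      0 < f l ∧ f r < 0 ∧ DifferentiableAt ℝ f p ∧ deriv f p ≤ -c k) :
    ENNReal.ofReal (2 * ∑ k ∈ Finset.Icc 1 n, c k - 2 * A) ≤ Rns f := by
  set S : Set ℝ := {x | DifferentiableAt ℝ f x} with hS
  have key : ∀ m ≤ n, (∑ k ∈ Finset.Icc 1 m, c k = 0) ∨ ∃ p r d, p < r ∧ r ≤ y m + ρ ∧ f r < 0 ∧
      p ∈ S ∧ deriv f p ≤ -d ∧ 0 ≤ d ∧ d ≤ A ∧
      ENNReal.ofReal (2 * ∑ k ∈ Finset.Icc 1 m, c k - A - d)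
        ≤ eVariationOn (deriv f) (S ∩ Iic p) := by
    intro m
    induction m with
    | zero => intro _; left; simp
    | succ m ih =>
      intro hm
      have hsum : ∑ k ∈ Finset.Icc 1 (m + 1), c k = ∑ k ∈ Finset.Icc 1 m, c k + c (m + 1) :=
        Finset.sum_Icc_succ_top (by omega) _
      rcases (hc (m + 1)).eq_or_lt with h0 | h0
      · rw [hsum, ← h0, add_zero]
        refine (ih (by omega)).imp id ?_
        rintro ⟨p, r, d, hpr, hr, h⟩
        exact ⟨p, r, d, hpr, by linarith [hy m], h⟩
      · obtain ⟨l, p', r', hl, hlp, hpr', hr', hfl, hfr', hdp', hp'⟩ :=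
          hcross (m + 1) (Finset.mem_Icc.2 ⟨by omega, hm⟩) h0
        right
        rcases ih (by omega) with h | ⟨p, r, d, hpr, hr, hfr, hpS, hdp, hd0, hdA, hvar⟩
        · refine ⟨p', r', c (m + 1), hpr', hr', hfr', hdp', hp', h0.le, hcA _, ?_⟩
          rw [hsum, h, ENNReal.ofReal_of_nonpos (by linarith [hcA (m + 1)])]
          exact zero_le
        · refine ⟨p', r', c (m + 1), hpr', hr', hfr', hdp', hp', h0.le, hcA _, ?_⟩
          obtain ⟨q, hq, hqd, hqpos⟩ := hpos r l (by linarith [hy m]) (hfr.trans hfl)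
          refine le_trans ?_ (eVariationOn_inter_Iic_add_le (S := S) hpS hqd hdp'
            (hpr.trans hq.1).le (hq.2.trans hlp).le hdp hqpos.le hp' hd0 h0.le)
          refine le_trans ?_ (add_le_add hvar le_rfl)
          refine le_trans (ENNReal.ofReal_le_ofReal ?_) ENNReal.ofReal_add_le
          rw [hsum]
          linarith
  rcases key n le_rfl with h | ⟨p, r, d, -, -, -, -, -, -, hdA, hvar⟩
  · rw [h, ENNReal.ofReal_of_nonpos (by linarith)]
    exact zero_le
  · refine le_trans (ENNReal.ofReal_le_ofReal ?_) (hvar.trans (eVariationOn.mono _ inter_subset_left))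
    linarith

lemma gaussD_nonneg (x : ℝ) {σ : ℝ} (hσ : 0 ≤ σ) : 0 ≤ gaussD x σ := by
  unfold gaussD
  positivity

@[fun_prop]
lemma continuous_gaussD (σ : ℝ) : Continuous fun x => gaussD x σ := by
  unfold gaussD
  fun_prop

lemma gaussD_neg (x σ : ℝ) : gaussD (-x) σ = gaussD x σ := by
  simp [gaussD]

lemma gaussD_one_eq_gaussianPDFReal (x : ℝ) :
    gaussD x 1 = ProbabilityTheory.gaussianPDFReal 0 1 x := by
  simp [gaussD, ProbabilityTheory.gaussianPDFReal]

lemma integral_gaussD_one_le (a b : ℝ) (hab : a ≤ b) : ∫ u in a..b, gaussD u 1 ≤ 1 := by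
  simp only [gaussD_one_eq_gaussianPDFReal]
  rw [← ProbabilityTheory.integral_gaussianPDFReal_eq_one 0 one_ne_zero,
    intervalIntegral.integral_of_le hab]
  exact setIntegral_le_integral (ProbabilityTheory.integrable_gaussianPDFReal 0 1)
    (Eventually.of_forall (ProbabilityTheory.gaussianPDFReal_nonneg 0 1))

lemma integral_Ioi_sq_mul_gaussD : ∫ u in Ioi (0 : ℝ), u ^ 2 * gaussD u 1 = 1 / 2 := by
  have h := integral_rpow_mul_exp_neg_mul_rpow (p := 2) (q := 2) (b := 1 / 2)
    (by norm_num) (by norm_num) (by norm_num)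
  have hΓ : Real.Gamma ((2 + 1) / 2) = √π / 2 := by
    rw [show ((2 : ℝ) + 1) / 2 = 1 / 2 + 1 by norm_num, Real.Gamma_add_one (by norm_num),
      Real.Gamma_one_half_eq]
    ring
  have hpow : ((1 : ℝ) / 2) ^ (-(2 + 1) / 2 : ℝ) = 2 * √2 := by
    rw [show (-(2 + 1) / 2 : ℝ) = -(1 + 1 / 2) by norm_num, Real.rpow_neg (by norm_num),
      ← Real.inv_rpow (by norm_num), Real.rpow_add (by norm_num), ← Real.sqrt_eq_rpow]
    norm_num
  rw [hΓ, hpow] at h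
  have heq : ∀ u : ℝ, u ^ 2 * gaussD u 1
      = (√(2 * π))⁻¹ * (u ^ (2 : ℝ) * rexp (-(1 / 2) * u ^ (2 : ℝ))) := by
    intro u
    rw [Real.rpow_two, gaussD, show -(1 / 2) * u ^ 2 = -u ^ 2 / (2 * 1 ^ 2) by ring]
    ring
  simp only [heq]
  rw [integral_const_mul, h, Real.sqrt_mul (by norm_num)]
  have h2 : √2 ≠ 0 := by positivity
  have hπ : √π ≠ 0 := by positivity
  field_simp

lemma integrable_sq_mul_gaussD : Integrable fun u : ℝ => u ^ 2 * gaussD u 1 := by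
  have h := (integrable_rpow_mul_exp_neg_mul_sq (b := 1 / 2) (by norm_num) (s := 2)
    (by norm_num)).const_mul (√(2 * π))⁻¹
  refine h.congr (Eventually.of_forall fun u => ?_)
  simp only [Real.rpow_two, gaussD]
  rw [show -(1 / 2) * u ^ 2 = -u ^ 2 / (2 * 1 ^ 2) by ring]
  ring

/-- Radii splitting the second moment of the standard Gaussian. -/
lemma exists_radii_second_moment : ∃ M M' : ℝ, 0 < M ∧ M < M' ∧
    ∫ u in (0 : ℝ)..M, u ^ 2 * gaussD u 1 = 0.2 ∧
    0.28 < ∫ u in M..M', u ^ 2 * gaussD u 1 := by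
  have hint : ∀ a b : ℝ, IntervalIntegrable (fun u : ℝ => u ^ 2 * gaussD u 1) volume a b :=
    fun a b => integrable_sq_mul_gaussD.intervalIntegrable
  have hlim := intervalIntegral_tendsto_integral_Ioi (0 : ℝ)
    integrable_sq_mul_gaussD.integrableOn tendsto_id
  rw [integral_Ioi_sq_mul_gaussD] at hlim
  obtain ⟨M', hM', hM'0⟩ := ((hlim.eventually (lt_mem_nhds
    (show (0.49 : ℝ) < 1 / 2 by norm_num))).and (eventually_gt_atTop 0)).exists
  simp only [id] at hM'
  have hcont := intervalIntegral.continuous_primitive hint 0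
  obtain ⟨M, hM, hMeq⟩ := intermediate_value_Icc hM'0.le hcont.continuousOn
    (show (0.2 : ℝ) ∈ Icc _ _ by
      rw [intervalIntegral.integral_same]
      exact ⟨by norm_num, by linarith⟩)
  simp only at hMeq
  refine ⟨M, M', hM.1.lt_of_ne ?_, hM.2.lt_of_ne ?_, hMeq, ?_⟩
  · rintro rfl
    rw [intervalIntegral.integral_same] at hMeq
    norm_num at hMeq
  · rintro rfl
    linarith
  · rw [← intervalIntegral.integral_interval_sub_left (hint 0 M') (hint 0 M), hMeq]
    linarith

lemma integral_sq_mul_gaussD_mono {h : ℝ → ℝ} (hh : Continuous h) {a b a' b' : ℝ}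
    (ha : a' ≤ a) (hab : a ≤ b) (hb : b ≤ b') :
    ∫ u in a..b, h u ^ 2 * gaussD u 1 ≤ ∫ u in a'..b', h u ^ 2 * gaussD u 1 :=
  intervalIntegral.integral_mono_interval ha hab hb
    (Eventually.of_forall fun u => mul_nonneg (sq_nonneg _) (gaussD_nonneg u zero_le_one))
    (Continuous.intervalIntegrable (by fun_prop) _ _)

/-- A function with small Gaussian second moment cannot have large symmetric increments. -/
lemma exists_increment_lt {h : ℝ → ℝ} (hh : Continuous h) {M M' e a : ℝ} (hM : 0 < M)
    (hMM' : M < M') (hm : ∫ u in (0 : ℝ)..M, u ^ 2 * gaussD u 1 = 0.2)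
    (he : ∫ u in (-M')..M', h u ^ 2 * gaussD u 1 ≤ e) (ha : 0 ≤ a) (hea : e < 0.4 * a ^ 2) :
    ∃ u ∈ Ioc 0 M, h u - h (-u) < 2 * a * u := by
  by_contra! hcon
  have h₁ := integral_sq_mul_gaussD_mono hh (neg_le_neg hMM'.le) (by linarith : -M ≤ M) hMM'.le
  have hc : Continuous fun u => h u ^ 2 * gaussD u 1 := by fun_prop
  rw [← intervalIntegral.integral_add_adjacent_intervals (b := 0) (hc.intervalIntegrable _ _)
    (hc.intervalIntegrable _ _)] at h₁
  have h₂ := intervalIntegral.integral_comp_neg (a := 0) (b := M) fun u => h u ^ 2 * gaussD u 1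
  rw [neg_zero] at h₂
  simp only [gaussD_neg] at h₂
  rw [← h₂, ← intervalIntegral.integral_add
    (Continuous.intervalIntegrable (by fun_prop) _ _) (hc.intervalIntegrable _ _)] at h₁
  have h₃ : ∫ u in (0 : ℝ)..M, 2 * a ^ 2 * (u ^ 2 * gaussD u 1) ≤
      ∫ u in (0 : ℝ)..M, (h (-u) ^ 2 * gaussD u 1 + h u ^ 2 * gaussD u 1) := by
    refine intervalIntegral.integral_mono_on hM.le
      (Continuous.intervalIntegrable (by fun_prop) _ _)
      (Continuous.intervalIntegrable (by fun_prop) _ _) fun u hu => ?_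
    have hinc : 2 * a * u ≤ h u - h (-u) := by
      rcases hu.1.eq_or_lt with h0 | h0
      · simp [← h0]
      · exact hcon u ⟨h0, hu.2⟩
    have hau : 0 ≤ 2 * a * u := mul_nonneg (by positivity) hu.1
    have hsq := pow_le_pow_left₀ hau hinc 2
    have : 2 * a ^ 2 * u ^ 2 ≤ h (-u) ^ 2 + h u ^ 2 := by nlinarith [sq_nonneg (h u + h (-u))]
    nlinarith [mul_le_mul_of_nonneg_right this (gaussD_nonneg u zero_le_one)]
  rw [intervalIntegral.integral_const_mul, hm] at h₃
  linarith

lemma exists_lt_id_of_integral_lt {h : ℝ → ℝ} (hh : Continuous h) {M M' : ℝ} (hM : 0 < M)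
    (hMM' : M < M') (hm : 0.28 < ∫ u in M..M', u ^ 2 * gaussD u 1)
    (he : ∫ u in (-M')..M', h u ^ 2 * gaussD u 1 ≤ 0.28) : ∃ u ∈ Icc M M', h u < u := by
  by_contra! hcon
  have h₁ := integral_sq_mul_gaussD_mono hh (by linarith : -M' ≤ M) hMM'.le le_rfl
  have h₂ : ∫ u in M..M', u ^ 2 * gaussD u 1 ≤ ∫ u in M..M', h u ^ 2 * gaussD u 1 := by
    refine intervalIntegral.integral_mono_on hMM'.le
      (Continuous.intervalIntegrable (by fun_prop) _ _)
      (Continuous.intervalIntegrable (by fun_prop) _ _) fun u hu => ?_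
    exact mul_le_mul_of_nonneg_right (pow_le_pow_left₀ (hM.le.trans hu.1) (hcon u hu) 2)
      (gaussD_nonneg u zero_le_one)
  linarith

lemma exists_neg_lt_of_integral_lt {h : ℝ → ℝ} (hh : Continuous h) {M M' : ℝ} (hM : 0 < M)
    (hMM' : M < M') (hm : 0.28 < ∫ u in M..M', u ^ 2 * gaussD u 1)
    (he : ∫ u in (-M')..M', h u ^ 2 * gaussD u 1 ≤ 0.28) : ∃ u ∈ Icc M M', -u < h (-u) := by
  have h₂ := intervalIntegral.integral_comp_neg (a := -M') (b := M')
    fun u => h u ^ 2 * gaussD u 1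
  rw [neg_neg] at h₂
  simp only [gaussD_neg] at h₂
  obtain ⟨u, hu, hlt⟩ := exists_lt_id_of_integral_lt (h := fun u => -h (-u)) (by fun_prop) hM
    hMM' hm (by simpa only [neg_sq, h₂] using he)
  exact ⟨u, hu, by linarith⟩

/-- If `f` is `L²`-close to the Gaussian score around `y` at scale `√t`, then it crosses from
positive to negative values there, with a slope close to `-1/t`. -/
lemma exists_crossing {f : ℝ → ℝ} (hf : Continuous f)
    (hfin : {x | ¬ DifferentiableAt ℝ f x}.Finite) {B : ℝ} (hB : ∀ x, |deriv f x| ≤ B)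
    {M M' : ℝ} (hM : 0 < M) (hMM' : M < M')
    (hm : ∫ u in (0 : ℝ)..M, u ^ 2 * gaussD u 1 = 0.2)
    (hm' : 0.28 < ∫ u in M..M', u ^ 2 * gaussD u 1) {t y e : ℝ} (ht : 0 < t) (he0 : 0 < e)
    (he1 : 1.9 * √e < 1)
    (he : ∫ u in (-M')..M', (√t * f (y + √t * u) + u) ^ 2 * gaussD u 1 ≤ e) :
    ∃ l p r, y - M' * √t ≤ l ∧ l < p ∧ p < r ∧ r ≤ y + M' * √t ∧ 0 < f l ∧ f r < 0 ∧
      DifferentiableAt ℝ f p ∧ deriv f p ≤ -((1 - 1.9 * √e) / t) := by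
  have hst : 0 < √t := Real.sqrt_pos.2 ht
  have hse : 0 < √e := Real.sqrt_pos.2 he0
  have hsq : √e ^ 2 = e := Real.sq_sqrt he0.le
  have htt : √t * √t = t := Real.mul_self_sqrt ht.le
  have hh : Continuous fun u => √t * f (y + √t * u) + u := by fun_prop
  have he28 : e ≤ 0.28 := by nlinarith
  obtain ⟨u₁, hu₁, h₁⟩ := exists_neg_lt_of_integral_lt hh hM hMM' hm' (he.trans he28)
  obtain ⟨u₂, hu₂, h₂⟩ := exists_lt_id_of_integral_lt hh hM hMM' hm' (he.trans he28)
  obtain ⟨u, hu, h₃⟩ := exists_increment_lt hh (a := 1.9 * √e) hM hMM' hm he (by positivity)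
    (by nlinarith)
  have hup : 0 < √t * u := mul_pos hst hu.1
  obtain ⟨p, hp, hd, hlt⟩ := exists_deriv_lt_of_sub_lt hf hfin hB
    (a := y + √t * -u) (b := y + √t * u) (m := -((1 - 1.9 * √e) / t)) (by linarith) (by
      have : √t * (f (y + √t * u) - f (y + √t * -u)) <
          √t * (-((1 - 1.9 * √e) / t) * (y + √t * u - (y + √t * -u))) := by
        have e1 : √t * (-((1 - 1.9 * √e) / t) * (y + √t * u - (y + √t * -u)))
            = -(1 - 1.9 * √e) * (2 * u) := by
          rw [show √t * (-((1 - 1.9 * √e) / t) * (y + √t * u - (y + √t * -u)))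
            = (√t * √t) * (-((1 - 1.9 * √e) / t) * (2 * u)) by ring, htt]
          field_simp
        rw [e1]
        linarith
      exact lt_of_mul_lt_mul_left this hst.le)
  refine ⟨y + √t * -u₁, p, y + √t * u₂, ?_, ?_, ?_, ?_, ?_, ?_, hd, hlt.le⟩
  · nlinarith [hu₁.2]
  · nlinarith [hp.1, hu₁.1, hu.2]
  · nlinarith [hp.2, hu₂.1, hu.2]
  · nlinarith [hu₂.2]
  · exact pos_of_mul_pos_right (by linarith : 0 < √t * f (y + √t * -u₁)) hst.le
  · by_contra! hcon
    have := mul_nonneg hst.le hcon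
    linarith

lemma gaussD_pos (x : ℝ) {σ : ℝ} (hσ : 0 < σ) : 0 < gaussD x σ := by
  unfold gaussD
  positivity

lemma abs_trainPt_le {n : ℕ} (hn : 2 ≤ n) {D : ℝ} (hD : 0 < D) {k : ℕ}
    (hk : k ∈ Finset.Icc 1 n) : |trainPt n D k| ≤ D := by
  obtain ⟨h1, h2⟩ := Finset.mem_Icc.1 hk
  have hn' : (0 : ℝ) < n - 1 := by
    have : (2 : ℝ) ≤ n := by exact_mod_cast hn
    linarith
  have h1' : (1 : ℝ) ≤ k := by exact_mod_cast h1
  have h2' : (k : ℝ) ≤ n := by exact_mod_cast h2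
  have hΔ : 0 < D / ((n : ℝ) - 1) := div_pos hD hn'
  have hmul : ((n : ℝ) - 1) * (D / ((n : ℝ) - 1)) = D := mul_div_cancel₀ D hn'.ne'
  unfold trainPt
  rw [abs_le]
  constructor <;> nlinarith

lemma trainPt_sub (n : ℕ) (D : ℝ) (j k : ℕ) :
    trainPt n D j - trainPt n D k = 2 * ((j : ℝ) - k) * (D / ((n : ℝ) - 1)) := by
  unfold trainPt
  ring

lemma le_abs_trainPt_sub {n : ℕ} (hn : 2 ≤ n) {D : ℝ} (hD : 0 < D) {j k : ℕ} (hjk : j ≠ k) :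
    2 * (D / ((n : ℝ) - 1)) ≤ |trainPt n D j - trainPt n D k| := by
  have hn' : (0 : ℝ) < n - 1 := by
    have : (2 : ℝ) ≤ n := by exact_mod_cast hn
    linarith
  have hΔ : 0 < D / ((n : ℝ) - 1) := div_pos hD hn'
  have hone : (1 : ℝ) ≤ |(j : ℝ) - k| := by
    have : (1 : ℤ) ≤ |(j : ℤ) - k| := Int.one_le_abs (by omega)
    exact_mod_cast this
  rw [trainPt_sub, abs_mul, abs_mul, abs_of_pos hΔ, abs_of_pos (zero_lt_two' ℝ)]
  nlinarith

lemma sum_gaussD_pos {n : ℕ} (hn : 2 ≤ n) (D : ℝ) {t : ℝ} (ht : 0 < t) (x : ℝ) :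
    0 < ∑ k ∈ Finset.Icc 1 n, gaussD (x - trainPt n D k) √t :=
  Finset.sum_pos (fun _ _ => gaussD_pos _ (Real.sqrt_pos.2 ht))
    (Finset.nonempty_Icc.2 (by omega))

lemma hasDerivAt_gaussD_sub {t : ℝ} (ht : 0 < t) (x y : ℝ) :
    HasDerivAt (fun z => gaussD (z - y) √t) (gaussD (x - y) √t * ((y - x) / t)) x := by
  unfold gaussD
  rw [Real.sq_sqrt ht.le]
  have h := ((((((hasDerivAt_id x).sub_const y).pow 2).neg).div_const (2 * t)).exp).const_mul
    (√(2 * π) * √t)⁻¹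
  refine h.congr_deriv ?_
  simp only [id, Pi.pow_apply, Pi.neg_apply]
  field_simp
  norm_num
  ring

lemma scoreEmp_eq {n : ℕ} (hn : 2 ≤ n) (D : ℝ) {t : ℝ} (ht : 0 < t) (x : ℝ) :
    scoreEmp n D t x =
      (∑ k ∈ Finset.Icc 1 n, gaussD (x - trainPt n D k) √t * ((trainPt n D k - x) / t)) /
        ∑ k ∈ Finset.Icc 1 n, gaussD (x - trainPt n D k) √t := by
  have hn0 : (n : ℝ) ≠ 0 := by positivity
  have hS := sum_gaussD_pos hn D ht x
  have hd : HasDerivAt (pEmp n D t) (1 / (n : ℝ) *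
      ∑ k ∈ Finset.Icc 1 n, gaussD (x - trainPt n D k) √t * ((trainPt n D k - x) / t)) x := by
    unfold pEmp
    exact (HasDerivAt.fun_sum fun k _ => hasDerivAt_gaussD_sub ht x (trainPt n D k)).const_mul _
  have hp : pEmp n D t x ≠ 0 := by
    unfold pEmp
    positivity
  unfold scoreEmp
  rw [(hd.log hp).deriv]
  unfold pEmp
  field_simp

lemma continuous_scoreEmp {n : ℕ} (hn : 2 ≤ n) (D : ℝ) {t : ℝ} (ht : 0 < t) :
    Continuous (scoreEmp n D t) := by
  rw [show scoreEmp n D t = _ from funext fun x => scoreEmp_eq hn D ht x]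
  refine Continuous.div ?_ ?_ fun x => (sum_gaussD_pos hn D ht x).ne'
  · exact continuous_finsetSum _ fun k _ =>
      ((continuous_gaussD _).comp (continuous_id.sub continuous_const)).mul (by fun_prop)
  · exact continuous_finsetSum _ fun k _ =>
      (continuous_gaussD _).comp (continuous_id.sub continuous_const)

/-- The score differs from that of a single Gaussian by a weighted mean of displacements. -/
lemma scoreEmp_sub_eq {n : ℕ} (hn : 2 ≤ n) (D : ℝ) {t : ℝ} (ht : 0 < t) (x y : ℝ) :
    scoreEmp n D t x - (y - x) / t =
      (∑ j ∈ Finset.Icc 1 n, gaussD (x - trainPt n D j) √t * ((trainPt n D j - y) / t)) /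
        ∑ j ∈ Finset.Icc 1 n, gaussD (x - trainPt n D j) √t := by
  have hS := (sum_gaussD_pos hn D ht x).ne'
  rw [scoreEmp_eq hn D ht, eq_div_iff hS, sub_mul, div_mul_cancel₀ _ hS, Finset.mul_sum,
    ← Finset.sum_sub_distrib]
  refine Finset.sum_congr rfl fun j _ => ?_
  ring

lemma abs_scoreEmp_le {n : ℕ} (hn : 2 ≤ n) {D : ℝ} (hD : 0 < D) {t : ℝ} (ht : 0 < t) (x : ℝ) :
    |scoreEmp n D t x| ≤ (D + |x|) / t := by
  have hS := sum_gaussD_pos hn D ht x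
  rw [scoreEmp_eq hn D ht, abs_div, abs_of_pos hS, div_le_iff₀ hS, Finset.mul_sum]
  refine (Finset.abs_sum_le_sum_abs _ _).trans (Finset.sum_le_sum fun k hk => ?_)
  have hg := gaussD_nonneg (x - trainPt n D k) (Real.sqrt_nonneg t)
  rw [abs_mul, abs_of_nonneg hg, mul_comm, abs_div, abs_of_pos ht]
  refine mul_le_mul_of_nonneg_right (div_le_div_of_nonneg_right ?_ ht.le) hg
  exact (abs_sub _ _).trans (add_le_add (abs_trainPt_le hn hD hk) le_rfl)

/-- Within `M √t` of a training point, the rescaled score is `O(√t)`-close to that of the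
Gaussian centered there. -/
lemma abs_sqrt_mul_scoreEmp_add_le {n : ℕ} (hn : 2 ≤ n) {D : ℝ} (hD : 0 < D) {t M : ℝ}
    (ht : 0 < t) (hMt : M * √t < D / ((n : ℝ) - 1)) {k : ℕ} (hk : k ∈ Finset.Icc 1 n) {u : ℝ}
    (hu : |u| ≤ M) :
    |√t * scoreEmp n D t (trainPt n D k + √t * u) + u| ≤
      4 * n * D * rexp (M ^ 2 / 2) / (D / ((n : ℝ) - 1)) ^ 2 * √t := by
  set Δ := D / ((n : ℝ) - 1) with hΔdef
  have hn' : (0 : ℝ) < n - 1 := by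
    have : (2 : ℝ) ≤ n := by exact_mod_cast hn
    linarith
  have hΔ : 0 < Δ := div_pos hD hn'
  have hst : 0 < √t := Real.sqrt_pos.2 ht
  have htt : √t * √t = t := Real.mul_self_sqrt ht.le
  set y := trainPt n D k with hy
  set x := y + √t * u with hx
  have hS := sum_gaussD_pos hn D ht x
  have hW := gaussD_pos (x - y) hst
  have hWS : gaussD (x - y) √t ≤ ∑ j ∈ Finset.Icc 1 n, gaussD (x - trainPt n D j) √t :=
    Finset.single_le_sum (f := fun j => gaussD (x - trainPt n D j) √t)
      (fun j _ => gaussD_nonneg _ hst.le) hk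
  have hMu : u ^ 2 ≤ M ^ 2 := sq_le_sq' (by linarith [abs_le.1 hu]) (abs_le.1 hu).2
  have hterm : ∀ j ∈ Finset.Icc 1 n,
      |gaussD (x - trainPt n D j) √t * ((trainPt n D j - y) / t)| ≤
        gaussD (x - y) √t * (4 * D * rexp (M ^ 2 / 2) / Δ ^ 2) := by
    intro j hj
    by_cases hjk : j = k
    · rw [hjk, ← hy, sub_self, zero_div, mul_zero, abs_zero]
      positivity
    · have hdist : Δ ≤ |x - trainPt n D j| := by
        have h1 := le_abs_trainPt_sub hn hD hjk
        have h2 : |trainPt n D j - y| ≤ |x - trainPt n D j| + |x - y| := by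
          rw [abs_sub_comm x (trainPt n D j)]
          exact (abs_sub_le (trainPt n D j) x y)
        have h3 : |x - y| ≤ M * √t := by
          rw [hx, add_sub_cancel_left, abs_mul, abs_of_pos hst, mul_comm]
          exact mul_le_mul_of_nonneg_right hu hst.le
        linarith
      have hsq : Δ ^ 2 ≤ (x - trainPt n D j) ^ 2 := by
        rw [← sq_abs (x - trainPt n D j)]
        exact pow_le_pow_left₀ hΔ.le hdist 2
      have hratio : gaussD (x - trainPt n D j) √t ≤
          gaussD (x - y) √t * (rexp (M ^ 2 / 2) * (2 * t / Δ ^ 2)) := by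
        have hexp : rexp (-(Δ ^ 2 / (2 * t))) ≤ 2 * t / Δ ^ 2 := by
          rw [Real.exp_neg, ← inv_div (Δ ^ 2) (2 * t)]
          refine inv_anti₀ (by positivity) ?_
          linarith [Real.add_one_le_exp (Δ ^ 2 / (2 * t))]
        have hmain : rexp (-(x - trainPt n D j) ^ 2 / (2 * t)) ≤
            rexp (-(x - y) ^ 2 / (2 * t)) * (rexp (M ^ 2 / 2) * rexp (-(Δ ^ 2 / (2 * t)))) := by
          rw [← Real.exp_add, ← Real.exp_add]
          refine Real.exp_le_exp.2 ?_
          have e1 : (x - y) ^ 2 / (2 * t) = u ^ 2 / 2 := by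
            rw [hx, add_sub_cancel_left, mul_pow, Real.sq_sqrt ht.le]
            field_simp
          have e2 : Δ ^ 2 / (2 * t) ≤ (x - trainPt n D j) ^ 2 / (2 * t) := by gcongr
          rw [neg_div, neg_div, e1]
          linarith
        unfold gaussD
        rw [Real.sq_sqrt ht.le, mul_assoc]
        refine mul_le_mul_of_nonneg_left (hmain.trans ?_) (by positivity)
        gcongr
      have hdiff : |trainPt n D j - y| ≤ 2 * D :=
        (abs_sub _ _).trans (by linarith [abs_trainPt_le hn hD hj, abs_trainPt_le hn hD hk])
      rw [abs_mul, abs_of_nonneg (gaussD_nonneg _ hst.le), abs_div, abs_of_pos ht]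
      calc gaussD (x - trainPt n D j) √t * (|trainPt n D j - y| / t)
          ≤ gaussD (x - y) √t * (rexp (M ^ 2 / 2) * (2 * t / Δ ^ 2)) * (2 * D / t) := by
            gcongr
        _ = gaussD (x - y) √t * (4 * D * rexp (M ^ 2 / 2) / Δ ^ 2) := by
            field_simp
            ring
  have hdiff : |scoreEmp n D t x - (y - x) / t| ≤ n * (4 * D * rexp (M ^ 2 / 2) / Δ ^ 2) := by
    rw [scoreEmp_sub_eq hn D ht, abs_div, abs_of_pos hS, div_le_iff₀ hS]
    refine (Finset.abs_sum_le_sum_abs _ _).trans ((Finset.sum_le_sum hterm).trans ?_)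
    rw [Finset.sum_const, Nat.card_Icc, nsmul_eq_mul, Nat.add_sub_cancel, mul_left_comm, mul_comm]
    gcongr
  have heq : √t * scoreEmp n D t x + u = √t * (scoreEmp n D t x - (y - x) / t) := by
    have : √t * ((y - x) / t) = -u := by
      rw [hx, sub_add_cancel_left, show √t * (-(√t * u) / t) = -(√t * √t) * u / t by ring, htt]
      field_simp
    rw [mul_sub, this]
    ring
  rw [heq, abs_mul, abs_of_pos hst, mul_comm]
  calc |scoreEmp n D t x - (y - x) / t| * √t
      ≤ n * (4 * D * rexp (M ^ 2 / 2) / Δ ^ 2) * √t := by gcongr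
    _ = _ := by ring

lemma integrable_quadratic_mul_gaussD {t : ℝ} (ht : 0 < t) (a b : ℝ) :
    Integrable fun x : ℝ => (a + b * x ^ 2) * gaussD x √t := by
  have hb : 0 < 1 / (2 * t) := by positivity
  have h1 := (integrable_rpow_mul_exp_neg_mul_sq hb (s := 2) (by norm_num)).const_mul
    (b * (√(2 * π) * √t)⁻¹)
  have h0 := (integrable_exp_neg_mul_sq hb).const_mul (a * (√(2 * π) * √t)⁻¹)
  refine (h0.add h1).congr (Eventually.of_forall fun x => ?_)
  simp only [Real.rpow_two, gaussD, Pi.add_apply]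
  rw [Real.sq_sqrt ht.le, show -(1 / (2 * t)) * x ^ 2 = -x ^ 2 / (2 * t) by ring]
  ring

lemma integrable_sq_abs_mul_gaussD_sub {g : ℝ → ℝ} (hg : Continuous g) {A B : ℝ}
    (hB : 0 ≤ B) (hgAB : ∀ x, |g x| ≤ A + B * |x|) {t : ℝ} (ht : 0 < t) (y : ℝ) :
    Integrable fun x => |g x| ^ 2 * gaussD (x - y) √t := by
  have hdom := (integrable_quadratic_mul_gaussD ht (2 * (A + B * |y|) ^ 2)
    (2 * B ^ 2)).comp_sub_right y
  have hcont : Continuous fun x => |g x| ^ 2 * gaussD (x - y) √t :=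
    (hg.abs.pow 2).mul ((continuous_gaussD _).comp (continuous_id.sub continuous_const))
  refine hdom.mono' hcont.aestronglyMeasurable (Eventually.of_forall fun x => ?_)
  have hgn := gaussD_nonneg (x - y) (Real.sqrt_nonneg t)
  rw [Real.norm_of_nonneg (mul_nonneg (by positivity) hgn)]
  refine mul_le_mul_of_nonneg_right ?_ hgn
  have h1 : |g x| ≤ (A + B * |y|) + B * |x - y| := by
    have : |x| ≤ |y| + |x - y| := by
      simpa using abs_add_le y (x - y)
    nlinarith [hgAB x]
  have h2 := pow_le_pow_left₀ (abs_nonneg _) h1 2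
  rw [← sq_abs (x - y)]
  nlinarith [sq_nonneg (A + B * |y| - B * |x - y|)]

lemma sqrt_mul_gaussD_sqrt_mul {t : ℝ} (ht : 0 < t) (u : ℝ) :
    √t * gaussD (√t * u) √t = gaussD u 1 := by
  have hst : 0 < √t := Real.sqrt_pos.2 ht
  unfold gaussD
  rw [show -(√t * u) ^ 2 / (2 * √t ^ 2) = -u ^ 2 / (2 * 1 ^ 2) by field_simp]
  field_simp

/-- The rescaled local errors around the training points are controlled by the loss. -/
lemma sum_local_error_le {n : ℕ} (hn : 2 ≤ n) {D : ℝ} (hD : 0 < D) {t : ℝ} (ht : 0 < t)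
    {f : ℝ → ℝ} (hf : Continuous f) {A B : ℝ} (hB : 0 ≤ B) (hfAB : ∀ x, |f x| ≤ A + B * |x|)
    {M : ℝ} (hM : 0 ≤ M) :
    ∑ k ∈ Finset.Icc 1 n, ∫ u in (-M)..M, (√t * f (trainPt n D k + √t * u) -
      √t * scoreEmp n D t (trainPt n D k + √t * u)) ^ 2 * gaussD u 1 ≤ n * scoreLoss n D t f := by
  have hn0 : (n : ℝ) ≠ 0 := by positivity
  have hst : 0 < √t := Real.sqrt_pos.2 ht
  set g : ℝ → ℝ := fun x => f x - scoreEmp n D t x with hg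
  have hgc : Continuous g := hf.sub (continuous_scoreEmp hn D ht)
  have hgAB : ∀ x, |g x| ≤ (A + D / t) + (B + 1 / t) * |x| := by
    intro x
    have h1 := abs_scoreEmp_le hn hD ht x
    have h2 : |g x| ≤ |f x| + |scoreEmp n D t x| := abs_sub _ _
    have h3 : (D + |x|) / t = D / t + 1 / t * |x| := by ring
    linarith [hfAB x]
  have hint : ∀ k, Integrable fun x => |g x| ^ 2 * gaussD (x - trainPt n D k) √t := fun k =>
    integrable_sq_abs_mul_gaussD_sub hgc (by positivity) hgAB ht _
  have hloss : n * scoreLoss n D t f =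
      ∑ k ∈ Finset.Icc 1 n, t * ∫ x, |g x| ^ 2 * gaussD (x - trainPt n D k) √t := by
    unfold scoreLoss pEmp
    rw [← Finset.mul_sum, ← integral_finsetSum _ fun k _ => hint k, mul_left_comm,
      ← integral_const_mul]
    congr 2
    ext x
    rw [← Finset.mul_sum]
    field_simp
    exact mul_comm _ _
  rw [hloss]
  refine Finset.sum_le_sum fun k _ => ?_
  set y := trainPt n D k
  have hsub := intervalIntegral.mul_integral_comp_add_mul (a := -M) (b := M)
    (f := fun x => |g x| ^ 2 * gaussD (x - y) √t) √t y
  have heq : ∫ u in (-M)..M, (√t * f (y + √t * u) - √t * scoreEmp n D t (y + √t * u)) ^ 2 *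
      gaussD u 1 = t * ∫ x in (y + √t * -M)..(y + √t * M), |g x| ^ 2 * gaussD (x - y) √t := by
    rw [← hsub, ← intervalIntegral.integral_const_mul, ← intervalIntegral.integral_const_mul]
    congr 1
    ext u
    rw [← sqrt_mul_gaussD_sqrt_mul ht u, add_sub_cancel_left, ← mul_sub, mul_pow,
      Real.sq_sqrt ht.le, sq_abs]
    ring
  rw [heq, intervalIntegral.integral_of_le (by nlinarith)]
  refine mul_le_mul_of_nonneg_left (setIntegral_le_integral (hint k)
    (Eventually.of_forall fun x => ?_)) ht.le
  exact mul_nonneg (by positivity) (gaussD_nonneg _ hst.le)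

/-- Replacing the score by that of a single Gaussian perturbs the local error only slightly. -/
lemma integral_sq_mul_gaussD_le_of_close {g s : ℝ → ℝ} (hg : Continuous g) (hs : Continuous s)
    {M η : ℝ} (hM : 0 ≤ M) (hclose : ∀ u, |u| ≤ M → |s u + u| ≤ η) :
    ∫ u in (-M)..M, (g u + u) ^ 2 * gaussD u 1 ≤
      1.05 * (∫ u in (-M)..M, (g u - s u) ^ 2 * gaussD u 1) + 21 * η ^ 2 := by
  have hle : ∫ u in (-M)..M, (g u + u) ^ 2 * gaussD u 1 ≤
      ∫ u in (-M)..M, (1.05 * ((g u - s u) ^ 2 * gaussD u 1) + 21 * η ^ 2 * gaussD u 1) := by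
    refine intervalIntegral.integral_mono_on (by linarith)
      (Continuous.intervalIntegrable (by fun_prop) _ _)
      (Continuous.intervalIntegrable (by fun_prop) _ _) fun u hu => ?_
    have h1 : (s u + u) ^ 2 ≤ η ^ 2 := by
      have := abs_le.1 (hclose u (abs_le.2 hu))
      exact sq_le_sq' this.1 this.2
    have h2 : (g u + u) ^ 2 ≤ 1.05 * (g u - s u) ^ 2 + 21 * η ^ 2 := by
      nlinarith [sq_nonneg ((g u - s u) - 20 * (s u + u))]
    have := mul_le_mul_of_nonneg_right h2 (gaussD_nonneg u zero_le_one)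
    linarith
  rw [intervalIntegral.integral_add (Continuous.intervalIntegrable (by fun_prop) _ _)
    (Continuous.intervalIntegrable (by fun_prop) _ _), intervalIntegral.integral_const_mul,
    intervalIntegral.integral_const_mul] at hle
  have := integral_gaussD_one_le (-M) M (by linarith)
  nlinarith [sq_nonneg η]

lemma abs_le_abs_zero_add_mul {f : ℝ → ℝ} (hf : Continuous f)
    (hfin : {x | ¬ DifferentiableAt ℝ f x}.Finite) {B : ℝ} (hB : ∀ x, |deriv f x| ≤ B) (x : ℝ) :
    |f x| ≤ |f 0| + B * |x| := by
  have h := intervalIntegral.norm_integral_le_of_norm_le_const (a := 0) (b := x) (f := deriv f)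
    fun z _ => hB z
  rw [integral_deriv_eq_sub_of_finite hf hfin hB, sub_zero, Real.norm_eq_abs] at h
  linarith [abs_sub_abs_le_abs_sub (f x) (f 0)]

/-- lower bound on the non-smoothness measure of any approximate score. -/
theorem stmt_3 (n : ℕ) (hn : 2 ≤ n) (D : ℝ) (hD : 0 < D)
    (ε : ℝ) (hε : ε ∈ Set.Ioo (0 : ℝ) 0.015) :
    ∃ t₁ > (0 : ℝ), ∃ C > (0 : ℝ), ∀ t ∈ Set.Ioo 0 t₁,
      ∀ f : ℝ → ℝ, Continuous f → {x | ¬ DifferentiableAt ℝ f x}.Finite →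
        scoreLoss n D t f < ε →
        ENNReal.ofReal (2 * ((n : ℝ) - 1 - 2 * n * Real.sqrt ε) / t -
            C * Real.exp (-(D / ((n : ℝ) - 1)) ^ 2 / (10 * t))) ≤ Rns f := by
  obtain ⟨M, M', hM, hMM', hm, hm'⟩ := exists_radii_second_moment
  have hM' : 0 < M' := hM.trans hMM'
  have hn1 : (0 : ℝ) < n - 1 := by
    have : (2 : ℝ) ≤ n := by exact_mod_cast hn
    linarith
  have hn0 : (0 : ℝ) < n := by linarith
  have hε0 : 0 < ε := hε.1
  set Δ := D / ((n : ℝ) - 1) with hΔdef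
  have hΔ : 0 < Δ := div_pos hD hn1
  set K := 4 * n * D * rexp (M' ^ 2 / 2) / Δ ^ 2 with hK
  have hK0 : 0 < K := by positivity
  refine ⟨min ((Δ / M') ^ 2) (0.05 * ε / (21 * K ^ 2)), by positivity, 1, one_pos, ?_⟩
  rintro t ⟨ht, htlt⟩ f hf hfin hL
  obtain ⟨ht₁, ht₂⟩ := lt_min_iff.1 htlt
  by_cases hR : Rns f = ⊤
  · rw [hR]
    exact le_top
  obtain ⟨B, hB0, hB⟩ := exists_abs_deriv_le_of_Rns_ne_top hR
  have hst : 0 < √t := Real.sqrt_pos.2 ht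
  have hMt : M' * √t < Δ := by
    have := (Real.sqrt_lt' (by positivity)).2 ht₁
    rwa [lt_div_iff₀ hM', mul_comm] at this
  have hKt : 21 * (K * √t) ^ 2 ≤ 0.05 * ε := by
    rw [lt_div_iff₀ (by positivity)] at ht₂
    rw [mul_pow, Real.sq_sqrt ht.le]
    linarith
  set err : ℕ → ℝ := fun k => ∫ u in (-M')..M', (√t * f (trainPt n D k + √t * u) -
    √t * scoreEmp n D t (trainPt n D k + √t * u)) ^ 2 * gaussD u 1 with herr
  have herr0 : ∀ k, 0 ≤ err k := fun k =>
    intervalIntegral.integral_nonneg (by linarith) fun u _ =>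
      mul_nonneg (sq_nonneg _) (gaussD_nonneg u zero_le_one)
  have hsum := sum_local_error_le hn hD ht hf hB0 (abs_le_abs_zero_add_mul hf hfin hB) hM'.le
  set e : ℕ → ℝ := fun k => 1.05 * err k + 0.05 * ε with he
  have he0 : ∀ k, 0 < e k := fun k => by
    have := herr0 k
    simp only [he]
    positivity
  have hclose : ∀ k ∈ Finset.Icc 1 n,
      ∫ u in (-M')..M', (√t * f (trainPt n D k + √t * u) + u) ^ 2 * gaussD u 1 ≤ e k := by
    intro k hk
    have hs := continuous_scoreEmp hn D ht
    refine (integral_sq_mul_gaussD_le_of_close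
      (s := fun u => √t * scoreEmp n D t (trainPt n D k + √t * u)) (by fun_prop) (by fun_prop)
      hM'.le fun u hu => abs_sqrt_mul_scoreEmp_add_le hn hD ht hMt hk hu).trans ?_
    exact add_le_add le_rfl hKt
  set c : ℕ → ℝ := fun k => max 0 ((1 - 1.9 * √(e k)) / t) with hc
  have hcross := ofReal_le_Rns_of_crossings (n := n) (y := trainPt n D) (c := c) (ρ := M' * √t)
    (A := 1 / t) (fun a b => exists_deriv_pos_of_lt hf hfin hB) (by positivity)
    (fun k => le_max_left _ _)
    (fun k => max_le (by positivity) (div_le_div_of_nonneg_right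
      (by linarith [Real.sqrt_nonneg (e k)]) ht.le))
    (fun k => by
      have := trainPt_sub n D (k + 1) k
      push_cast at this
      linarith)
    (by positivity)
    (fun k hk hck => by
      have hpos : 0 < (1 - 1.9 * √(e k)) / t := (lt_max_iff.1 hck).resolve_left (lt_irrefl 0)
      have hlt : 1.9 * √(e k) < 1 := by linarith [(div_pos_iff_of_pos_right ht).1 hpos]
      obtain ⟨l, p, r, h⟩ :=
        exists_crossing hf hfin hB hM hMM' hm hm' ht (he0 k) hlt (hclose k hk)
      exact ⟨l, p, r, by rwa [show c k = _ from max_eq_right hpos.le]⟩)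
  refine (ENNReal.ofReal_le_ofReal ?_).trans hcross
  have hsqrt : 1.9 * ∑ k ∈ Finset.Icc 1 n, √(e k) ≤ 2 * n * √ε := by
    have hcs := sq_sum_le_card_mul_sum_sq (s := Finset.Icc 1 n) (f := fun k => √(e k))
    simp only [Real.sq_sqrt (he0 _).le, Nat.card_Icc, Nat.add_sub_cancel] at hcs
    have hesum : ∑ k ∈ Finset.Icc 1 n, e k ≤ 1.1 * (n * ε) := by
      simp only [he]
      rw [Finset.sum_add_distrib, ← Finset.mul_sum, Finset.sum_const, Nat.card_Icc,
        Nat.add_sub_cancel, nsmul_eq_mul]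
      have := mul_le_mul_of_nonneg_left hL.le hn0.le
      linarith
    refine le_of_sq_le_sq ?_ (by positivity)
    rw [mul_pow, mul_pow, Real.sq_sqrt hε0.le]
    have := mul_le_mul_of_nonneg_left hesum hn0.le
    nlinarith [mul_pos (mul_pos hn0 hn0) hε0]
  have hcsum : ((n : ℝ) - 2 * n * √ε) / t ≤ ∑ k ∈ Finset.Icc 1 n, c k := by
    calc ((n : ℝ) - 2 * n * √ε) / t
        ≤ (n - 1.9 * ∑ k ∈ Finset.Icc 1 n, √(e k)) / t := by gcongr
      _ = ∑ k ∈ Finset.Icc 1 n, (1 - 1.9 * √(e k)) / t := by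
          rw [← Finset.sum_div, Finset.sum_sub_distrib, ← Finset.mul_sum]
          simp
      _ ≤ ∑ k ∈ Finset.Icc 1 n, c k := Finset.sum_le_sum fun k _ => le_max_right _ _
  have hexp := Real.exp_pos (-Δ ^ 2 / (10 * t))
  have hsplit : 2 * ((n : ℝ) - 1 - 2 * n * √ε) / t
      = 2 * (((n : ℝ) - 2 * n * √ε) / t) - 2 * (1 / t) := by ring
  linarith
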